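/- Let 0 < η ≤ 1/(2|Y|) and let R ⊊ X be nonempty. Let Q_η ∈ P_η(Y) attain the pseudo-capacity C_η(W_R) = max_{r∈R} D(P_r‖Q_η), and let x ∈ X be a maximizer of x ↦ D(P_x‖Q_η) over X. Let r* ∈ R be a minimizer of r ↦ χ²(P_x‖P_r) over R (the nearest neighbor of x); assume supp(P_x) ⊆ supp(P_{r*}) and η ≤ κ, where κ = min{P_{r*}(y) : y ∈ Y, P_{r*}(y) > 0}, and set χ = χ²(P_x‖P_{r*}). Then C(W_X) − C(W_R) ≤ 4·|Y|·η + χ + √((−log η)·(C(W_R) − log κ)) · √χ. -/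

import Mathlib

open scoped BigOperators Classical

/-- A probability mass function on a finite alphabet `Y`. -/
def IsPmf {Y : Type*} [Fintype Y] (p : Y → ℝ) : Prop :=
  (∀ y, 0 ≤ p y) ∧ ∑ y, p y = 1

/-- The real-valued KL sum `∑_{y : p y > 0} p y * log (p y / q y)` (natural log). -/
noncomputable def klReal {Y : Type*} [Fintype Y] (p q : Y → ℝ) : ℝ :=
  ∑ y, if 0 < p y then p y * Real.log (p y / q y) else 0

/-- KL divergence in `[0,∞] ⊆ EReal`, with the convention `D(p‖q) = ⊤`
if `supp p ⊄ supp q`. -/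
noncomputable def KL {Y : Type*} [Fintype Y] (p q : Y → ℝ) : EReal :=
  if ∀ y, 0 < p y → 0 < q y then ((klReal p q : ℝ) : EReal) else ⊤

/-- The capacity of the channel restricted to input symbols in `S`,
via the minimax (information-radius) formula, with convention `C(W_∅) = 0`. -/
noncomputable def capacity {X Y : Type*} [Fintype X] [Fintype Y]
    (P : X → Y → ℝ) (S : Set X) : EReal :=
  if S.Nonempty then
    ⨅ Q : {Q : Y → ℝ // IsPmf Q}, ⨆ x : S, KL (P (x : X)) Q.1
  else 0

/-- The pseudo-capacity: the information radius over the pseudo-simplex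
`P_η(Y) = {Q pmf : Q y ≥ η ∀ y}`, with the convention for `S = ∅` set to `0`. -/
noncomputable def pseudoCapacity {X Y : Type*} [Fintype X] [Fintype Y]
    (η : ℝ) (P : X → Y → ℝ) (S : Set X) : EReal :=
  if S.Nonempty then
    ⨅ Q : {Q : Y → ℝ // IsPmf Q ∧ ∀ y, η ≤ Q y}, ⨆ x : S, KL (P (x : X)) Q.1
  else 0

/-- The χ²-divergence `χ²(p‖q) = ∑_{y : q y > 0} (p y - q y)² / q y`. -/
noncomputable def chiSq {Y : Type*} [Fintype Y] (p q : Y → ℝ) : ℝ :=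
  ∑ y, if 0 < q y then (p y - q y) ^ 2 / q y else 0

section CapacityLoss

variable {X Y : Type*} [Fintype X] [Fintype Y]

lemma sq_le_mul_exp_neg_sub_one_add {u L : ℝ} (hL : 0 ≤ L) (hu : u ≤ L) :
    u ^ 2 ≤ (L + 2) * (Real.exp (-u) - 1 + u) := by
  have hpos : 0 ≤ Real.exp (-u) - 1 + u := by linarith [Real.add_one_le_exp (-u)]
  rcases le_total 0 u with h | h
  · have h1 : 1 ≤ Real.exp u := Real.one_le_exp h
    have h2 := Real.le_log_one_add_of_nonneg (sub_nonneg.2 h1)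
    rw [add_sub_cancel, Real.log_exp, div_le_iff₀ (by linarith)] at h2
    have h3 : Real.exp (-u) * Real.exp u = 1 := by rw [← Real.exp_add]; simp
    have h4 : 2 - u ≤ (u + 2) * Real.exp (-u) := by
      have := mul_le_mul_of_nonneg_right h2 (Real.exp_pos (-u)).le
      nlinarith
    nlinarith
  · have h1 := Real.quadratic_le_exp_of_nonneg (neg_nonneg.2 h)
    nlinarith

lemma IsPmf.le_one {p : Y → ℝ} (hp : IsPmf p) (y : Y) : p y ≤ 1 :=
  hp.2 ▸ Finset.single_le_sum (fun i _ => hp.1 i) (Finset.mem_univ y)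

lemma klReal_eq_sum {p : Y → ℝ} (hp : IsPmf p) (q : Y → ℝ) :
    klReal p q = ∑ y, p y * Real.log (p y / q y) := by
  refine Finset.sum_congr rfl fun y _ => ?_
  split_ifs with h
  · rfl
  · rw [le_antisymm (not_lt.1 h) (hp.1 y), zero_mul]

lemma klReal_nonneg {p q : Y → ℝ} (hp : IsPmf p) (hq : IsPmf q)
    (hpq : ∀ y, 0 < p y → 0 < q y) : 0 ≤ klReal p q := by
  have h : ∑ y, (p y - q y) ≤ klReal p q := by
    refine Finset.sum_le_sum fun y _ => ?_
    split_ifs with h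
    · have hq0 := hpq y h
      have h1 := Real.one_sub_inv_le_log_of_pos (div_pos h hq0)
      have h2 := mul_le_mul_of_nonneg_left h1 h.le
      have h3 : p y * (1 - (p y / q y)⁻¹) = p y - q y := by field_simp
      linarith
    · linarith [hq.1 y]
  simpa [Finset.sum_sub_distrib, hp.2, hq.2] using h

lemma chiSq_nonneg (p q : Y → ℝ) : 0 ≤ chiSq p q := by
  refine Finset.sum_nonneg fun y _ => ?_
  split_ifs with h <;> positivity

/-- Linearizing the logarithm at `b` bounds the KL divergence by the χ²-divergence. -/
lemma klReal_le_chiSq {p q : Y → ℝ} (hp : IsPmf p) (hq : IsPmf q)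
    (hpq : ∀ y, 0 < p y → 0 < q y) {b : ℝ} (hb : 0 < b) :
    klReal p q ≤ (1 + chiSq p q) / b + Real.log b - 1 := by
  have h : klReal p q ≤ ∑ y, (((if 0 < q y then (p y - q y) ^ 2 / q y else 0) + 2 * p y - q y) / b
      + p y * (Real.log b - 1)) := by
    refine Finset.sum_le_sum fun y _ => ?_
    by_cases h : 0 < p y
    · have hq0 := hpq y h
      rw [if_pos h, if_pos hq0]
      have h1 := Real.log_le_sub_one_of_pos (div_pos (div_pos h hq0) hb)
      rw [Real.log_div (div_pos h hq0).ne' hb.ne'] at h1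
      have h2 := mul_le_mul_of_nonneg_left h1 h.le
      have h3 : ((p y - q y) ^ 2 / q y + 2 * p y - q y) / b = p y * (p y / q y / b) := by
        field_simp
        ring
      rw [h3]
      linarith
    · have h0 : p y = 0 := le_antisymm (not_lt.1 h) (hp.1 y)
      rw [if_neg h, h0]
      split_ifs with hq0
      · have : ((0 - q y) ^ 2 / q y + 2 * 0 - q y) / b + 0 * (Real.log b - 1) = 0 := by
          field_simp
          ring
        exact this.ge
      · simp [le_antisymm (not_lt.1 hq0) (hq.1 y)]
  refine h.trans (le_of_eq ?_)
  rw [Finset.sum_add_distrib, ← Finset.sum_div, Finset.sum_sub_distrib, Finset.sum_add_distrib,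
    ← Finset.sum_mul, ← Finset.mul_sum, hp.2, hq.2, chiSq]
  ring

lemma sum_mul_sq_log_le {p q : Y → ℝ} (hp : IsPmf p) (hq : IsPmf q) {L : ℝ} (hL : 0 ≤ L)
    (hq0 : ∀ y, Real.exp (-L) ≤ q y) :
    ∑ y, p y * Real.log (p y / q y) ^ 2 ≤ (L + 2) * klReal p q := by
  have h : ∑ y, p y * Real.log (p y / q y) ^ 2 ≤
      ∑ y, (L + 2) * (q y - p y + p y * Real.log (p y / q y)) := by
    refine Finset.sum_le_sum fun y _ => ?_
    have hqp : 0 < q y := (Real.exp_pos _).trans_le (hq0 y)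
    rcases (hp.1 y).eq_or_lt with h | h
    · rw [← h]
      have : 0 ≤ (L + 2) * q y := by positivity
      simpa using this
    · have hu : Real.log (p y / q y) ≤ L := by
        rw [Real.log_le_iff_le_exp (div_pos h hqp), div_le_iff₀ hqp]
        have h1 : Real.exp L * Real.exp (-L) = 1 := by rw [← Real.exp_add]; simp
        have h2 := mul_le_mul_of_nonneg_left (hq0 y) (Real.exp_pos L).le
        linarith [hp.le_one y]
      have h1 := mul_le_mul_of_nonneg_left (sq_le_mul_exp_neg_sub_one_add hL hu) h.le
      rw [Real.exp_neg, Real.exp_log (div_pos h hqp)] at h1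
      refine h1.trans (le_of_eq ?_)
      field_simp
  refine h.trans (le_of_eq ?_)
  rw [← Finset.mul_sum, Finset.sum_add_distrib, Finset.sum_sub_distrib, hp.2, hq.2,
    klReal_eq_sum hp]
  ring

/-- Changing the first argument of the KL divergence from `p` to `a`, controlled by the
χ²-divergence and the variance of the log-likelihood ratio. -/
lemma klReal_le_klReal_add {a p q : Y → ℝ} (ha : IsPmf a) (hp : IsPmf p) (hq : IsPmf q)
    (hap : ∀ y, 0 < a y → 0 < p y) {L : ℝ} (hL : 0 ≤ L) (hq0 : ∀ y, Real.exp (-L) ≤ q y) :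
    klReal a q ≤ klReal a p + klReal p q +
      Real.sqrt (chiSq a p) * Real.sqrt ((L + 2) * klReal p q - klReal p q ^ 2) := by
  have hqp : ∀ y, 0 < q y := fun y => (Real.exp_pos _).trans_le (hq0 y)
  set D := klReal p q with hD
  have hDs : D = ∑ y, p y * Real.log (p y / q y) := klReal_eq_sum hp q
  have ha0 : ∀ y, p y = 0 → a y = 0 := fun y h => by
    by_contra h'
    exact (hap y (lt_of_le_of_ne (ha.1 y) (Ne.symm h'))).ne' h
  have h1 : klReal a q = klReal a p + ∑ y, a y * Real.log (p y / q y) := by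
    rw [klReal_eq_sum ha, klReal_eq_sum ha, ← Finset.sum_add_distrib]
    refine Finset.sum_congr rfl fun y _ => ?_
    rcases (ha.1 y).eq_or_lt with h | h
    · simp [← h]
    · rw [← mul_add, ← Real.log_mul (div_pos h (hap y h)).ne' (div_pos (hap y h) (hqp y)).ne']
      have := (hap y h).ne'
      congr 2
      field_simp
  have h2 : ∑ y, a y * Real.log (p y / q y) - D =
      ∑ y, ((a y - p y) / Real.sqrt (p y)) * (Real.sqrt (p y) * (Real.log (p y / q y) - D)) := by
    have : ∑ y, ((a y - p y) / Real.sqrt (p y)) * (Real.sqrt (p y) * (Real.log (p y / q y) - D)) =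
        ∑ y, (a y * Real.log (p y / q y) - p y * Real.log (p y / q y) - (a y - p y) * D) := by
      refine Finset.sum_congr rfl fun y _ => ?_
      rcases (hp.1 y).eq_or_lt with h | h
      · simp [← h, ha0 y h.symm]
      · have := (Real.sqrt_pos.2 h).ne'
        field_simp
    rw [this, Finset.sum_sub_distrib, Finset.sum_sub_distrib, ← Finset.sum_mul,
      Finset.sum_sub_distrib, ha.2, hp.2, ← hDs]
    ring
  have h3 := Real.sum_mul_le_sqrt_mul_sqrt Finset.univ (fun y => (a y - p y) / Real.sqrt (p y))
    (fun y => Real.sqrt (p y) * (Real.log (p y / q y) - D))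
  have h4 : ∑ y, ((a y - p y) / Real.sqrt (p y)) ^ 2 = chiSq a p := by
    refine Finset.sum_congr rfl fun y _ => ?_
    rw [div_pow, Real.sq_sqrt (hp.1 y)]
    split_ifs with h
    · rfl
    · rw [le_antisymm (not_lt.1 h) (hp.1 y), div_zero]
  have h5 : ∑ y, (Real.sqrt (p y) * (Real.log (p y / q y) - D)) ^ 2 ≤ (L + 2) * D - D ^ 2 := by
    have : ∑ y, (Real.sqrt (p y) * (Real.log (p y / q y) - D)) ^ 2 =
        ∑ y, (p y * Real.log (p y / q y) ^ 2 - 2 * D * (p y * Real.log (p y / q y))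
          + p y * D ^ 2) := by
      refine Finset.sum_congr rfl fun y _ => ?_
      rw [mul_pow, Real.sq_sqrt (hp.1 y)]
      ring
    rw [this, Finset.sum_add_distrib, Finset.sum_sub_distrib, ← Finset.mul_sum, ← Finset.sum_mul,
      hp.2, ← hDs]
    have := sum_mul_sq_log_le hp hq hL hq0
    linarith
  have h6 := mul_le_mul_of_nonneg_left (Real.sqrt_le_sqrt h5) (Real.sqrt_nonneg (chiSq a p))
  rw [h4, ← h2] at h3
  linarith

lemma KL_nonneg {p q : Y → ℝ} (hp : IsPmf p) (hq : IsPmf q) : 0 ≤ KL p q := by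
  unfold KL
  split_ifs with h
  · exact_mod_cast klReal_nonneg hp hq h
  · exact le_top

lemma capacity_nonneg {P : X → Y → ℝ} (hP : ∀ x, IsPmf (P x)) (S : Set X) :
    0 ≤ capacity P S := by
  unfold capacity
  split_ifs with h
  · obtain ⟨r, hr⟩ := h
    exact le_iInf fun Q => (KL_nonneg (hP r) Q.2).trans
      (le_iSup (fun x : S => KL (P (x : X)) Q.1) ⟨r, hr⟩)
  · exact le_rfl

lemma KL_eq_klReal {p q : Y → ℝ} (hq : ∀ y, 0 < q y) : KL p q = (klReal p q : EReal) :=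
  if_pos fun y _ => hq y

/-- Mixing `q` with the uniform distribution increases the KL divergence by little. -/
lemma klReal_mix_sub_le_KL {p q : Y → ℝ} (hp : IsPmf p) {t η : ℝ} (ht : t < 1)
    (hη : 0 ≤ η) :
    ((klReal p (fun y => (1 - t) * q y + η) + Real.log (1 - t) : ℝ) : EReal) ≤ KL p q := by
  unfold KL
  split_ifs with h
  · refine EReal.coe_le_coe_iff.2 ?_
    have ht' : 0 < 1 - t := by linarith
    have h1 : Real.log (1 - t) = ∑ y, p y * Real.log (1 - t) := by
      rw [← Finset.sum_mul, hp.2, one_mul]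
    rw [klReal_eq_sum hp, klReal_eq_sum hp, h1, ← Finset.sum_add_distrib]
    refine Finset.sum_le_sum fun y _ => ?_
    rcases (hp.1 y).eq_or_lt with h0 | h0
    · simp [← h0]
    · have hq0 := h y h0
      have hm : 0 < (1 - t) * q y := mul_pos ht' hq0
      rw [← mul_add]
      refine mul_le_mul_of_nonneg_left ?_ h0.le
      have h2 := Real.log_le_log hm (show (1 - t) * q y ≤ (1 - t) * q y + η by linarith)
      rw [Real.log_mul ht'.ne' hq0.ne'] at h2
      rw [Real.log_div h0.ne' (by positivity), Real.log_div h0.ne' hq0.ne']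
      linarith
  · exact le_top

lemma coe_add_log_le_capacity_of_le_pseudoCapacity {P : X → Y → ℝ} (hP : ∀ x, IsPmf (P x))
    {η : ℝ} (hη : 0 < η) (hη1 : Fintype.card Y * η < 1) {R : Set X} (hR : R.Nonempty) {D : ℝ}
    (hD : (D : EReal) ≤ pseudoCapacity η P R) :
    ((D + Real.log (1 - Fintype.card Y * η) : ℝ) : EReal) ≤ capacity P R := by
  unfold capacity
  unfold pseudoCapacity at hD
  rw [if_pos hR] at hD ⊢
  refine le_iInf fun Q => ?_
  have hmix : ∀ y, η ≤ (1 - Fintype.card Y * η) * Q.1 y + η := fun y => by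
    have := mul_nonneg (sub_nonneg.2 hη1.le) (Q.2.1 y)
    linarith
  have hpmf : IsPmf (fun y => (1 - Fintype.card Y * η) * Q.1 y + η) := by
    refine ⟨fun y => hη.le.trans (hmix y), ?_⟩
    rw [Finset.sum_add_distrib, ← Finset.mul_sum, Q.2.2]
    simp
  have h1 := hD.trans (iInf_le _ ⟨_, hpmf, hmix⟩)
  have : Nonempty R := hR.to_subtype
  obtain ⟨r, hr⟩ := exists_eq_ciSup_of_finite (f := fun x : R =>
    KL (P (x : X)) (fun y => (1 - Fintype.card Y * η) * Q.1 y + η))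
  rw [← hr, KL_eq_klReal fun y => hη.trans_le (hmix y), EReal.coe_le_coe_iff] at h1
  refine le_trans ?_ ((klReal_mix_sub_le_KL (hP r) hη1 hη.le).trans
    (le_iSup (fun x : R => KL (P (x : X)) Q.1) r))
  exact EReal.coe_le_coe_iff.2 (by linarith)

lemma capacity_univ_le_KL {P : X → Y → ℝ} {Q : Y → ℝ} (hQ : IsPmf Q) {x : X}
    (hx : ∀ x', KL (P x') Q ≤ KL (P x) Q) : capacity P Set.univ ≤ KL (P x) Q := by
  unfold capacity
  rw [if_pos ⟨x, Set.mem_univ x⟩]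
  exact (iInf_le _ ⟨Q, hQ⟩).trans (iSup_le fun x' => hx x')

/-- A pmf whose positive masses all exceed `1 / 2` is a point mass. -/
lemma IsPmf.eq_of_half_lt {a p : Y → ℝ} (ha : IsPmf a) (hp : IsPmf p)
    (hap : ∀ y, 0 < a y → 0 < p y) (hhalf : ∀ y, 0 < p y → 1 / 2 < p y) : a = p := by
  obtain ⟨y₀, hy₀⟩ : ∃ y, 0 < p y := by
    by_contra! h
    have := Finset.sum_nonpos fun y (_ : y ∈ Finset.univ) => h y
    linarith [hp.2]
  have hp0 : ∀ y, y ≠ y₀ → p y = 0 := fun y hy => by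
    by_contra h
    have h1 := hhalf y (lt_of_le_of_ne (hp.1 y) (Ne.symm h))
    have h2 := hhalf y₀ hy₀
    have h3 := Finset.sum_le_univ_sum_of_nonneg (s := {y, y₀}) hp.1
    rw [Finset.sum_pair hy, hp.2] at h3
    linarith
  have ha0 : ∀ y, y ≠ y₀ → a y = 0 := fun y hy => by
    by_contra h
    exact (hap y (lt_of_le_of_ne (ha.1 y) (Ne.symm h))).ne' (hp0 y hy)
  have h1 : a y₀ = 1 := by rw [← ha.2, Fintype.sum_eq_single y₀ ha0]
  have h2 : p y₀ = 1 := by rw [← hp.2, Fintype.sum_eq_single y₀ hp0]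
  funext y
  by_cases hy : y = y₀
  · rw [hy, h1, h2]
  · rw [ha0 y hy, hp0 y hy]

lemma sqrt_variance_bound {L K C D s t χ d : ℝ} (hK : Real.log 2 ≤ K) (hL : 2 * Real.log 2 ≤ L)
    (hC : 0 ≤ C) (hχ : 0 ≤ χ) (ht : 0 ≤ t) (hDs : D ≤ C + s) (hst : s ≤ 2 * t)
    (hs2 : s ≤ Real.log 2) (hsmall : t < 1 / 5 → s ≤ 1 / 4 ∧ Real.log 10 ≤ L)
    (hd : d ≤ χ) (hd' : d ≤ χ / 2 + Real.log 2 - 1 / 2) :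
    d + D + Real.sqrt χ * Real.sqrt ((L + 2) * D - D ^ 2) ≤
      C + (4 * t + χ + Real.sqrt (L * (C + K)) * Real.sqrt χ) := by
  have hl1 := Real.log_two_gt_d9
  have hl2 := Real.log_two_lt_d9
  have hL0 : 0 ≤ L := by linarith
  have hz := Real.sqrt_nonneg χ
  have hz2 := Real.sq_sqrt hχ
  have hV : (L + 2) * D - D ^ 2 ≤ L * (C + K) + (1 - L * (K - s)) := by
    nlinarith [sq_nonneg (D - 1), mul_le_mul_of_nonneg_left hDs hL0]
  rcases lt_or_ge t (1 / 5) with h | h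
  · obtain ⟨hs, hL10⟩ := hsmall h
    have hlog10 : 2.279 ≤ Real.log 10 := by
      have h1 : Real.log 10 = 3 * Real.log 2 + Real.log (5 / 4) := by
        rw [show (10 : ℝ) = 2 ^ 3 * (5 / 4) by norm_num, Real.log_mul (by norm_num) (by norm_num),
          Real.log_pow]
        norm_num
      have h2 := Real.one_sub_inv_le_log_of_pos (show (0 : ℝ) < 5 / 4 by norm_num)
      norm_num at h2
      linarith
    have hLK : 1 ≤ L * (K - s) := by nlinarith
    have := mul_le_mul_of_nonneg_left
      (Real.sqrt_le_sqrt (show (L + 2) * D - D ^ 2 ≤ L * (C + K) by linarith)) hz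
    linarith
  · have hA : 0.96 ≤ L * (C + K) := by nlinarith
    have hw := Real.sqrt_nonneg (L * (C + K))
    have hw2 := Real.sq_sqrt (show 0 ≤ L * (C + K) by linarith)
    have hw1 : 0.97 ≤ Real.sqrt (L * (C + K)) := Real.le_sqrt_of_sq_le (by linarith)
    have hV1 : Real.sqrt ((L + 2) * D - D ^ 2) ≤ Real.sqrt (L * (C + K)) + 0.52 := by
      refine Real.sqrt_le_iff.2 ⟨by linarith, ?_⟩
      have : 0 ≤ L * (K - s) := mul_nonneg hL0 (by linarith)
      nlinarith
    have := mul_le_mul_of_nonneg_left hV1 hz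
    nlinarith [sq_nonneg (Real.sqrt χ - 0.52)]

end CapacityLoss

/-- simplified main theorem: the capacity loss from using only the
input symbols in `R ⊊ X` is bounded as
`C(W_X) − C(W_R) ≤ 4|Y|η + χ + √((−log η)(C(W_R) − log κ)) √χ`, where
`χ = χ²(P_x‖P_{r*})` for the `D(·‖Q_η)`-maximizing symbol `x` and its nearest
neighbor `r* ∈ R`, whose smallest positive mass is `κ ≥ η`. -/
theorem capacity_loss_le_nearest_neighbor_bound
    {X Y : Type*} [Fintype X] [Fintype Y] [Nonempty Y]
    (P : X → Y → ℝ) (hP : ∀ x', IsPmf (P x'))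
    (η : ℝ) (hη : 0 < η) (hη2 : η ≤ 1 / (2 * (Fintype.card Y : ℝ)))
    (R : Set X) (hR : R.Nonempty) (hRne : R ≠ Set.univ)
    (Qη : Y → ℝ) (hQη : IsPmf Qη) (hQηlb : ∀ y, η ≤ Qη y)
    (hQηatt : pseudoCapacity η P R = ⨆ r : R, KL (P (r : X)) Qη)
    (x : X) (hx : ∀ x', KL (P x') Qη ≤ KL (P x) Qη)
    (rstar : X) (hrstarR : rstar ∈ R)
    (hrstarmin : ∀ r ∈ R, chiSq (P x) (P rstar) ≤ chiSq (P x) (P r))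
    (hsupp : ∀ y, 0 < P x y → 0 < P rstar y)
    (κ : ℝ) (hκmem : ∃ y, 0 < P rstar y ∧ P rstar y = κ)
    (hκmin : ∀ y, 0 < P rstar y → κ ≤ P rstar y) (hηκ : η ≤ κ)
    (C : ℝ) (hC : capacity P R = ((C : ℝ) : EReal)) :
    capacity P Set.univ - capacity P R ≤
      ((4 * (Fintype.card Y : ℝ) * η + chiSq (P x) (P rstar) +
        Real.sqrt ((-Real.log η) * (C - Real.log κ)) *
          Real.sqrt (chiSq (P x) (P rstar)) : ℝ) : EReal) := by
  have hn : (1 : ℝ) ≤ Fintype.card Y := by exact_mod_cast Fintype.card_pos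
  have ht2 : Fintype.card Y * η ≤ 1 / 2 := by
    rw [le_div_iff₀ (by linarith)] at hη2
    linarith
  have ht0 : 0 < Fintype.card Y * η := by positivity
  have hη4 : η ≤ 1 / 2 := by nlinarith
  have hQpos : ∀ y, 0 < Qη y := fun y => hη.trans_le (hQηlb y)
  have hC0 : 0 ≤ C := by
    have := capacity_nonneg hP R
    rw [hC] at this
    exact_mod_cast this
  have hD : klReal (P rstar) Qη ≤ C + -Real.log (1 - Fintype.card Y * η) := by
    have h1 : (klReal (P rstar) Qη : EReal) ≤ pseudoCapacity η P R := by
      rw [hQηatt, ← KL_eq_klReal hQpos]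
      exact le_iSup (fun r : R => KL (P (r : X)) Qη) ⟨rstar, hrstarR⟩
    have h2 := coe_add_log_le_capacity_of_le_pseudoCapacity hP hη (by linarith) hR h1
    rw [hC, EReal.coe_le_coe_iff] at h2
    linarith
  have hlog : -Real.log (1 - Fintype.card Y * η) ≤
      (1 - Fintype.card Y * η)⁻¹ - 1 := by
    linarith [Real.one_sub_inv_le_log_of_pos
      (show 0 < 1 - Fintype.card Y * η by linarith)]
  have hs2t : -Real.log (1 - Fintype.card Y * η) ≤ 2 * (Fintype.card Y * η) := by
    refine hlog.trans ?_
    rw [sub_le_iff_le_add, inv_le_iff_one_le_mul₀ (by linarith)]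
    nlinarith
  have hχ := chiSq_nonneg (P x) (P rstar)
  have key : klReal (P x) Qη ≤ C + (4 * (Fintype.card Y * η) + chiSq (P x) (P rstar) +
      Real.sqrt ((-Real.log η) * (C + -Real.log κ)) * Real.sqrt (chiSq (P x) (P rstar))) := by
    obtain ⟨y₀, hy₀, hy₀κ⟩ := hκmem
    have hκ0 : 0 < κ := hy₀κ ▸ hy₀
    rcases lt_or_ge (1 / 2) κ with hκ | hκ
    · rw [(hP x).eq_of_half_lt (hP rstar) hsupp fun y hy => hκ.trans_le (hκmin y hy)] at hχ ⊢
      have := mul_nonneg (Real.sqrt_nonneg ((-Real.log η) * (C + -Real.log κ)))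
        (Real.sqrt_nonneg (chiSq (P rstar) (P rstar)))
      linarith
    · have hn2 : (2 : ℝ) ≤ Fintype.card Y := by
        by_contra! h
        have h1 : Fintype.card Y ≤ 1 := by
          have : Fintype.card Y < 2 := by exact_mod_cast h
          omega
        have := Fintype.card_le_one_iff_subsingleton.1 h1
        have h2 := (hP rstar).2
        rw [Fintype.sum_subsingleton _ y₀] at h2
        linarith
      have hK : Real.log 2 ≤ -Real.log κ := by
        rw [← Real.log_inv]
        exact Real.log_le_log (by norm_num) ((le_inv_comm₀ (by norm_num) hκ0).2 (by linarith))
      have hLlb : ∀ c : ℝ, 0 < c → c * η ≤ 1 → Real.log c ≤ -Real.log η := fun c hc h => by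
        rw [← Real.log_inv]
        exact Real.log_le_log hc ((le_inv_mul_iff₀ hη).2 (by linarith) |>.trans_eq (mul_one _))
      have hL : 2 * Real.log 2 ≤ -Real.log η := by
        have h1 := hLlb (2 ^ 2) (by norm_num) (by nlinarith)
        rw [Real.log_pow] at h1
        exact_mod_cast h1
      have hL0 : 0 ≤ -Real.log η := by linarith [Real.log_two_gt_d9]
      have h1 := klReal_le_klReal_add (hP x) (hP rstar) hQη hsupp hL0 fun y => by
        rw [neg_neg, Real.exp_log hη]
        exact hQηlb y
      refine h1.trans (sqrt_variance_bound hK hL hC0 hχ ht0.le hD hs2t ?_ ?_ ?_ ?_)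
      · rw [← Real.log_inv]
        exact Real.log_le_log (inv_pos.2 (by linarith))
          ((inv_le_comm₀ (by linarith) (by norm_num)).2 (by linarith))
      · refine fun ht => ⟨hlog.trans ?_, hLlb 10 (by norm_num) (by nlinarith)⟩
        rw [sub_le_iff_le_add, inv_le_iff_one_le_mul₀ (by linarith)]
        linarith
      · have := klReal_le_chiSq (hP x) (hP rstar) hsupp one_pos
        simpa using this
      · have := klReal_le_chiSq (hP x) (hP rstar) hsupp two_pos
        linarith
  have hcap := capacity_univ_le_KL hQη hx
  rw [KL_eq_klReal hQpos] at hcap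
  rw [hC]
  refine (EReal.sub_le_sub hcap le_rfl).trans ?_
  rw [← EReal.coe_sub, EReal.coe_le_coe_iff, mul_assoc 4, sub_eq_add_neg C]
  linarith
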